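/- arXiv:2604.24423 — 2 statements merged into one kernel-verified Lean document; each statement's English description precedes it below -/
import Mathlib

section
/- For every real m×m matrix Z, the support function of the separable correlation set satisfies φ_{C_sep}(Z) = ‖AᵀZB‖_∞ = s_1(AᵀZB), the largest singular value of the real 3×3 matrix AᵀZB. -/
open Matrix Kronecker
open scoped ENNReal ComplexOrder

namespace BellCorr

/-- The three Pauli matrices. -/
noncomputable def pauli (k : Fin 3) : Matrix (Fin 2) (Fin 2) ℂ :=
  if k = 0 then !![0, 1; 1, 0]
  else if k = 1 then !![0, -Complex.I; Complex.I, 0]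
  else !![1, 0; 0, -1]

/-- The observable `Â_i = ∑ k A i k • σ_k` associated with row `i` of `A`. -/
noncomputable def obs {m : ℕ} (A : Matrix (Fin m) (Fin 3) ℝ) (i : Fin m) :
    Matrix (Fin 2) (Fin 2) ℂ :=
  ∑ k : Fin 3, (A i k : ℂ) • pauli k

/-- The correlation map `Φ_AB`, sending a 4×4 complex matrix to the real m×m matrix
with entries `Tr[ρ (Â_i ⊗ B̂_j)]`. -/
noncomputable def corr {m : ℕ} (A B : Matrix (Fin m) (Fin 3) ℝ)
    (ρ : Matrix (Fin 2 × Fin 2) (Fin 2 × Fin 2) ℂ) : Matrix (Fin m) (Fin m) ℝ :=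
  Matrix.of fun i j => ((ρ * (obs A i ⊗ₖ obs B j)).trace).re

/-- Separable states: convex hull of products of 2×2 PSD trace-one matrices. -/
noncomputable def Ssep : Set (Matrix (Fin 2 × Fin 2) (Fin 2 × Fin 2) ℂ) :=
  convexHull ℝ {ρ | ∃ ρA ρB : Matrix (Fin 2) (Fin 2) ℂ,
    ρA.PosSemidef ∧ ρA.trace = 1 ∧ ρB.PosSemidef ∧ ρB.trace = 1 ∧ ρ = ρA ⊗ₖ ρB}

/-- Quantum states: 4×4 PSD matrices of trace one. -/
def Sqm : Set (Matrix (Fin 2 × Fin 2) (Fin 2 × Fin 2) ℂ) :=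
  {ρ | ρ.PosSemidef ∧ ρ.trace = 1}

/-- Maximal-tensor-product states: self-adjoint trace-one matrices pairing
nonnegatively with every product of PSD matrices. -/
def Smax : Set (Matrix (Fin 2 × Fin 2) (Fin 2 × Fin 2) ℂ) :=
  {ρ | ρ.IsHermitian ∧ ρ.trace = 1 ∧
    ∀ P Q : Matrix (Fin 2) (Fin 2) ℂ, P.PosSemidef → Q.PosSemidef →
      0 ≤ ((ρ * (P ⊗ₖ Q)).trace).re}

noncomputable def Csep {m : ℕ} (A B : Matrix (Fin m) (Fin 3) ℝ) :
    Set (Matrix (Fin m) (Fin m) ℝ) := corr A B '' Ssep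

noncomputable def Cqm {m : ℕ} (A B : Matrix (Fin m) (Fin 3) ℝ) :
    Set (Matrix (Fin m) (Fin m) ℝ) := corr A B '' Sqm

noncomputable def Cmax {m : ℕ} (A B : Matrix (Fin m) (Fin 3) ℝ) :
    Set (Matrix (Fin m) (Fin m) ℝ) := corr A B '' Smax

/-- Support function `φ_K(Z) = sup_{C ∈ K} Tr[Zᵀ C]`. -/
noncomputable def suppFn {m : ℕ} (K : Set (Matrix (Fin m) (Fin m) ℝ))
    (Z : Matrix (Fin m) (Fin m) ℝ) : ℝ :=
  sSup ((fun C => (Zᵀ * C).trace) '' K)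

/-- Gauge function `γ_K(C) = inf {t > 0 : C/t ∈ K}`, with value `+∞` if no such `t` exists. -/
noncomputable def gaugeFn {m : ℕ} (K : Set (Matrix (Fin m) (Fin m) ℝ))
    (C : Matrix (Fin m) (Fin m) ℝ) : ℝ≥0∞ :=
  ⨅ (t : ℝ) (_ : 0 < t ∧ t⁻¹ • C ∈ K), ENNReal.ofReal t

/-- `XᵀX` is Hermitian for a real matrix `X`. -/
lemma isHermitian_tr_mul_self (X : Matrix (Fin 3) (Fin 3) ℝ) : (Xᵀ * X).IsHermitian := by
  simpa [Matrix.conjTranspose_eq_transpose_of_trivial] using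
    Matrix.isHermitian_conjTranspose_mul_self X

/-- The singular values of a real 3×3 matrix, in decreasing order:
`sval X 0 ≥ sval X 1 ≥ sval X 2 ≥ 0` are the square roots of the eigenvalues of `XᵀX`. -/
noncomputable def sval (X : Matrix (Fin 3) (Fin 3) ℝ) (i : Fin 3) : ℝ :=
  Real.sqrt ((isHermitian_tr_mul_self X).eigenvalues
    (Tuple.sort (isHermitian_tr_mul_self X).eigenvalues i.rev))

/-- Column space of a real matrix. -/
noncomputable def colSpace {m n : ℕ} (X : Matrix (Fin m) (Fin n) ℝ) :
    Submodule ℝ (Fin m → ℝ) := LinearMap.range X.mulVecLin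

/-- `Y` is the Moore–Penrose pseudoinverse of `X`. -/
def IsMP {m n : ℕ} (X : Matrix (Fin m) (Fin n) ℝ) (Y : Matrix (Fin n) (Fin m) ℝ) : Prop :=
  X * Y * X = X ∧ Y * X * Y = Y ∧ (X * Y)ᵀ = X * Y ∧ (Y * X)ᵀ = Y * X

/-- The Bloch vector of a 2×2 complex matrix. -/
noncomputable def bloch (ρ : Matrix (Fin 2) (Fin 2) ℂ) (k : Fin 3) : ℝ :=
  ((ρ * pauli k).trace).re

lemma trace_mul_pauli {ρ : Matrix (Fin 2) (Fin 2) ℂ} (h : ρ.IsHermitian) (k : Fin 3) :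
    (ρ * pauli k).trace = (bloch ρ k : ℂ) := by
  have h00 := congrArg Complex.im (h.apply 0 0)
  have h11 := congrArg Complex.im (h.apply 1 1)
  have h01r := congrArg Complex.re (h.apply 0 1)
  have h01i := congrArg Complex.im (h.apply 0 1)
  simp at h00 h11 h01r h01i
  apply Complex.ext
  · simp [bloch]
  · fin_cases k <;> simp [pauli, Matrix.trace_fin_two, Matrix.mul_apply, Fin.sum_univ_two] <;>
      linarith

lemma trace_mul_obs {m : ℕ} (A : Matrix (Fin m) (Fin 3) ℝ) {ρ : Matrix (Fin 2) (Fin 2) ℂ}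
    (h : ρ.IsHermitian) (i : Fin m) :
    (ρ * obs A i).trace = ((A *ᵥ bloch ρ) i : ℝ) := by
  simp [obs, Matrix.mul_sum, Matrix.trace_sum, trace_mul_pauli h, Matrix.mulVec, dotProduct]

lemma corr_kronecker {m : ℕ} (A B : Matrix (Fin m) (Fin 3) ℝ) {ρA ρB : Matrix (Fin 2) (Fin 2) ℂ}
    (hA : ρA.IsHermitian) (hB : ρB.IsHermitian) :
    corr A B (ρA ⊗ₖ ρB) = vecMulVec (A *ᵥ bloch ρA) (B *ᵥ bloch ρB) := by
  ext i j
  rw [corr, Matrix.of_apply, ← Matrix.mul_kronecker_mul, Matrix.trace_kronecker,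
    trace_mul_obs A hA, trace_mul_obs B hB, ← Complex.ofReal_mul, Complex.ofReal_re,
    vecMulVec_apply]

lemma trace_corr_kronecker {m : ℕ} (A B : Matrix (Fin m) (Fin 3) ℝ) (Z : Matrix (Fin m) (Fin m) ℝ)
    {ρA ρB : Matrix (Fin 2) (Fin 2) ℂ} (hA : ρA.IsHermitian) (hB : ρB.IsHermitian) :
    (Zᵀ * corr A B (ρA ⊗ₖ ρB)).trace = bloch ρA ⬝ᵥ (Aᵀ * Z * B) *ᵥ bloch ρB := by
  rw [corr_kronecker A B hA hB, Matrix.mul_vecMulVec, Matrix.trace_vecMulVec,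
    Matrix.mulVec_transpose, ← Matrix.dotProduct_mulVec, ← Matrix.mulVec_mulVec,
    ← Matrix.mulVec_mulVec, Matrix.dotProduct_mulVec (bloch ρA), Matrix.vecMul_transpose]

lemma bloch_dotProduct_self_le_one {ρ : Matrix (Fin 2) (Fin 2) ℂ} (h : ρ.PosSemidef)
    (ht : ρ.trace = 1) : bloch ρ ⬝ᵥ bloch ρ ≤ 1 := by
  have h00 := congrArg Complex.im (h.1.apply 0 0)
  have h11 := congrArg Complex.im (h.1.apply 1 1)
  have h01r := congrArg Complex.re (h.1.apply 0 1)
  have h01i := congrArg Complex.im (h.1.apply 0 1)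
  have hd := (Complex.le_def.1 h.det_nonneg).1
  have htr := congrArg Complex.re ht
  simp [Matrix.det_fin_two, Matrix.trace_fin_two] at h00 h11 h01r h01i hd htr
  have e0 : (ρ 0 0).im = 0 := by linarith
  have e1 : (ρ 1 1).im = 0 := by linarith
  simp only [dotProduct, Fin.sum_univ_three, bloch]
  simp [pauli, Matrix.trace_fin_two, Matrix.mul_apply, Fin.sum_univ_two]
  rw [e0, h01r, ← h01i] at hd
  rw [h01r, ← h01i]
  have e2 : (ρ 1 1).re = 1 - (ρ 0 0).re := by linarith
  rw [e2] at hd ⊢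
  nlinarith

/-- The density matrix with Bloch vector `v`. -/
noncomputable def ofBloch (v : Fin 3 → ℝ) : Matrix (Fin 2) (Fin 2) ℂ :=
  !![(1 + v 2) / 2, (v 0 - v 1 * Complex.I) / 2; (v 0 + v 1 * Complex.I) / 2, (1 - v 2) / 2]

lemma trace_ofBloch (v : Fin 3 → ℝ) : (ofBloch v).trace = 1 := by
  simp [ofBloch, Matrix.trace_fin_two]; ring

lemma bloch_ofBloch (v : Fin 3 → ℝ) : bloch (ofBloch v) = v := by
  ext k
  fin_cases k <;>
    simp [bloch, ofBloch, pauli, Matrix.trace_fin_two] <;> ring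

lemma posSemidef_ofBloch {v : Fin 3 → ℝ} (hv : v ⬝ᵥ v = 1) : (ofBloch v).PosSemidef := by
  have h : ofBloch v = (ofBloch v)ᴴ * ofBloch v := by
    simp only [dotProduct, Fin.sum_univ_three] at hv
    ext i j
    fin_cases i <;> fin_cases j <;>
      simp [ofBloch, Matrix.mul_apply, Complex.ext_iff, map_ofNat (starRingEnd ℂ) 2] <;>
      constructor <;> nlinarith
  rw [h]
  exact Matrix.posSemidef_conjTranspose_mul_self _

lemma mulVec_dotProduct_mulVec_self (X : Matrix (Fin 3) (Fin 3) ℝ) (b : Fin 3 → ℝ) :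
    (X *ᵥ b) ⬝ᵥ (X *ᵥ b) = b ⬝ᵥ (Xᵀ * X) *ᵥ b := by
  rw [← Matrix.mulVec_mulVec, Matrix.dotProduct_mulVec b, Matrix.vecMul_transpose]

lemma eigenvalues_le_sort_last (X : Matrix (Fin 3) (Fin 3) ℝ) (i : Fin 3) :
    (isHermitian_tr_mul_self X).eigenvalues i ≤ (isHermitian_tr_mul_self X).eigenvalues
      (Tuple.sort (isHermitian_tr_mul_self X).eigenvalues (Fin.rev 0)) := by
  have := Tuple.monotone_sort (isHermitian_tr_mul_self X).eigenvalues
    (Fin.le_last ((Tuple.sort (isHermitian_tr_mul_self X).eigenvalues).symm i))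
  simpa using this

lemma sval_zero_sq (X : Matrix (Fin 3) (Fin 3) ℝ) :
    sval X 0 ^ 2 = (isHermitian_tr_mul_self X).eigenvalues
      (Tuple.sort (isHermitian_tr_mul_self X).eigenvalues (Fin.rev 0)) := by
  refine Real.sq_sqrt (Matrix.PosSemidef.eigenvalues_nonneg ?_ _)
  simpa [Matrix.conjTranspose_eq_transpose_of_trivial] using
    Matrix.posSemidef_conjTranspose_mul_self X

lemma mulVec_dotProduct_self_le (X : Matrix (Fin 3) (Fin 3) ℝ) (b : Fin 3 → ℝ) :
    (X *ᵥ b) ⬝ᵥ (X *ᵥ b) ≤ sval X 0 ^ 2 * (b ⬝ᵥ b) := by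
  set hM := isHermitian_tr_mul_self X
  have key : ∀ x y : Fin 3 → ℝ, x ⬝ᵥ y =
      ∑ i, (x ⬝ᵥ (hM.eigenvectorBasis i).ofLp) * ((hM.eigenvectorBasis i).ofLp ⬝ᵥ y) := by
    intro x y
    have := hM.eigenvectorBasis.sum_inner_mul_inner (WithLp.toLp 2 x) (WithLp.toLp 2 y)
    simp only [EuclideanSpace.inner_eq_star_dotProduct, star_trivial] at this
    rw [dotProduct_comm x y, ← this]
    refine Finset.sum_congr rfl fun i _ => ?_
    rw [dotProduct_comm x, dotProduct_comm _ y]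
  have eig : ∀ i, (hM.eigenvectorBasis i).ofLp ⬝ᵥ (Xᵀ * X) *ᵥ b =
      hM.eigenvalues i * ((hM.eigenvectorBasis i).ofLp ⬝ᵥ b) := by
    intro i
    rw [Matrix.dotProduct_mulVec, ← Matrix.mulVec_transpose, Matrix.transpose_mul,
      Matrix.transpose_transpose, hM.mulVec_eigenvectorBasis, smul_dotProduct, smul_eq_mul]
  rw [mulVec_dotProduct_mulVec_self, key, key b b, Finset.mul_sum, sval_zero_sq]
  refine Finset.sum_le_sum fun i _ => ?_
  rw [eig, dotProduct_comm b]
  nlinarith [eigenvalues_le_sort_last X i, mul_self_nonneg ((hM.eigenvectorBasis i).ofLp ⬝ᵥ b)]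

lemma exists_mulVec_dotProduct_self_eq (X : Matrix (Fin 3) (Fin 3) ℝ) :
    ∃ b : Fin 3 → ℝ, b ⬝ᵥ b = 1 ∧ (X *ᵥ b) ⬝ᵥ (X *ᵥ b) = sval X 0 ^ 2 := by
  set hM := isHermitian_tr_mul_self X
  set i := Tuple.sort hM.eigenvalues (Fin.rev 0) with hi
  have hb : (hM.eigenvectorBasis i).ofLp ⬝ᵥ (hM.eigenvectorBasis i).ofLp = 1 := by
    have := hM.eigenvectorBasis.inner_eq_one i
    simpa only [EuclideanSpace.inner_eq_star_dotProduct, star_trivial] using this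
  refine ⟨(hM.eigenvectorBasis i).ofLp, hb, ?_⟩
  rw [mulVec_dotProduct_mulVec_self, hM.mulVec_eigenvectorBasis, dotProduct_smul, hb,
    smul_eq_mul, mul_one, sval_zero_sq]

lemma sval_nonneg (X : Matrix (Fin 3) (Fin 3) ℝ) (i : Fin 3) : 0 ≤ sval X i := Real.sqrt_nonneg _

lemma dotProduct_mulVec_le_sval (X : Matrix (Fin 3) (Fin 3) ℝ) {a b : Fin 3 → ℝ}
    (ha : a ⬝ᵥ a ≤ 1) (hb : b ⬝ᵥ b ≤ 1) : a ⬝ᵥ X *ᵥ b ≤ sval X 0 := by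
  have h := mulVec_dotProduct_self_le X b
  have hcs : (a ⬝ᵥ X *ᵥ b) ^ 2 ≤ (a ⬝ᵥ a) * ((X *ᵥ b) ⬝ᵥ (X *ᵥ b)) := by
    simpa only [dotProduct, ← pow_two] using Finset.sum_mul_sq_le_sq_mul_sq Finset.univ a (X *ᵥ b)
  have h0 : 0 ≤ (X *ᵥ b) ⬝ᵥ (X *ᵥ b) := Finset.sum_nonneg fun _ _ => mul_self_nonneg _
  refine (abs_le_of_sq_le_sq' ?_ (sval_nonneg X 0)).2
  nlinarith [sq_nonneg (sval X 0)]

lemma exists_dotProduct_mulVec_eq_sval (X : Matrix (Fin 3) (Fin 3) ℝ) :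
    ∃ a b : Fin 3 → ℝ, a ⬝ᵥ a = 1 ∧ b ⬝ᵥ b = 1 ∧ a ⬝ᵥ X *ᵥ b = sval X 0 := by
  obtain ⟨b, hb, h⟩ := exists_mulVec_dotProduct_self_eq X
  by_cases hs : sval X 0 = 0
  · rw [hs, zero_pow two_ne_zero, dotProduct_self_eq_zero] at h
    exact ⟨b, b, hb, hb, by rw [h, hs, dotProduct_zero]⟩
  · refine ⟨(sval X 0)⁻¹ • X *ᵥ b, b, ?_, hb, ?_⟩
    · rw [smul_dotProduct, dotProduct_smul, h, smul_eq_mul, smul_eq_mul]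
      field_simp
    · rw [smul_dotProduct, h, smul_eq_mul]
      field_simp

/-- The functional `ρ ↦ Tr[Zᵀ Φ_AB(ρ)]` is real-linear. -/
lemma isLinearMap_trace_corr {m : ℕ} (A B : Matrix (Fin m) (Fin 3) ℝ)
    (Z : Matrix (Fin m) (Fin m) ℝ) :
    IsLinearMap ℝ fun ρ => (Zᵀ * corr A B ρ).trace where
  map_add ρ τ := by
    rw [← Matrix.trace_add, ← Matrix.mul_add]
    congr 2
    ext i j
    simp [corr, Matrix.add_mul]
  map_smul c ρ := by
    rw [← Matrix.trace_smul, ← Matrix.mul_smul]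
    congr 2
    ext i j
    simp [corr]

/-- Support function of the separable correlation set:
`φ_{C_sep}(Z) = ‖AᵀZB‖_∞ = s₁(AᵀZB)`. -/
theorem stmt0 {m : ℕ} (hm : 1 ≤ m) (A B : Matrix (Fin m) (Fin 3) ℝ)
    (hA : ∀ i, ∑ k, A i k ^ 2 = 1) (hB : ∀ i, ∑ k, B i k ^ 2 = 1)
    (Z : Matrix (Fin m) (Fin m) ℝ) :
    suppFn (Csep A B) Z = sval (Aᵀ * Z * B) 0 := by
  obtain ⟨a, b, ha, hb, hab⟩ := exists_dotProduct_mulVec_eq_sval (Aᵀ * Z * B)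
  refine IsGreatest.csSup_eq ⟨?_, ?_⟩
  · have hρa := posSemidef_ofBloch ha
    have hρb := posSemidef_ofBloch hb
    refine ⟨_, ⟨_, subset_convexHull ℝ _
      ⟨ofBloch a, ofBloch b, hρa, trace_ofBloch a, hρb, trace_ofBloch b, rfl⟩, rfl⟩, ?_⟩
    simp only [trace_corr_kronecker A B Z hρa.1 hρb.1, bloch_ofBloch, hab]
  · rintro _ ⟨_, ⟨ρ, hρ, rfl⟩, rfl⟩
    refine convexHull_min ?_ (convex_halfSpace_le (isLinearMap_trace_corr A B Z)
      (sval (Aᵀ * Z * B) 0)) hρ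
    rintro _ ⟨ρA, ρB, hA, hAt, hB, hBt, rfl⟩
    rw [Set.mem_ofPred_eq, trace_corr_kronecker A B Z hA.1 hB.1]
    exact dotProduct_mulVec_le_sval _ (bloch_dotProduct_self_le_one hA hAt)
      (bloch_dotProduct_self_le_one hB hBt)

end BellCorr
end

section
/- For every real m×m matrix Z, the support function of the quantum correlation set satisfies φ_{C_qm}(Z) = s_1 + s_2 − sgn(det(AᵀZB))·s_3, where s_1 ≥ s_2 ≥ s_3 ≥ 0 are the singular values of the real 3×3 matrix AᵀZB. -/
open Matrix Kronecker
open scoped ENNReal ComplexOrder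

namespace BellCorr

/-- The Pauli matrix in the direction of a real 3-vector. -/
noncomputable def pauliVec (u : Fin 3 → ℝ) : Matrix (Fin 2) (Fin 2) ℂ :=
  ∑ k : Fin 3, (u k : ℂ) • pauli k

lemma pauliVec_apply (u : Fin 3 → ℝ) :
    pauliVec u = !![(u 2 : ℂ), u 0 - u 1 * Complex.I; u 0 + u 1 * Complex.I, -u 2] := by
  ext i j
  fin_cases i <;> fin_cases j <;> simp [pauliVec, pauli, Fin.sum_univ_three] <;> ring

lemma pauliVec_mul (u v : Fin 3 → ℝ) :
    pauliVec u * pauliVec v =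
      ((u ⬝ᵥ v : ℝ) : ℂ) • 1 + Complex.I • pauliVec (crossProduct u v) := by
  simp only [pauliVec_apply]
  ext i j
  fin_cases i <;> fin_cases j <;>
    simp [Matrix.mul_apply, cross_apply, dotProduct, Fin.sum_univ_three] <;>
    (ring_nf; simp only [Complex.I_sq]; ring)

lemma pauliVec_isHermitian (u : Fin 3 → ℝ) : (pauliVec u).IsHermitian := by
  rw [pauliVec_apply]
  ext i j
  fin_cases i <;> fin_cases j <;> simp <;> ring

lemma pauliVec_trace (u : Fin 3 → ℝ) : (pauliVec u).trace = 0 := by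
  rw [pauliVec_apply]; simp [Matrix.trace_fin_two]

lemma pauliVec_smul (c : ℝ) (u : Fin 3 → ℝ) : pauliVec (c • u) = (c : ℂ) • pauliVec u := by
  simp only [pauliVec, Pi.smul_apply, smul_eq_mul, Complex.ofReal_mul, Finset.smul_sum, smul_smul]

lemma pauliVec_mul_self {u : Fin 3 → ℝ} (hu : u ⬝ᵥ u = 1) : pauliVec u * pauliVec u = 1 := by
  rw [pauliVec_mul, hu, cross_self]
  simp [pauliVec]

/-- The columns of an orthogonal matrix form a frame whose handedness is its determinant. -/
lemma crossProduct_col_of_orthogonal {U : Matrix (Fin 3) (Fin 3) ℝ} (hU : Uᵀ * U = 1) :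
    crossProduct (U.col 0) (U.col 1) = U.det • U.col 2 := by
  have h : U.adjugate = U.det • Uᵀ := by
    calc U.adjugate = (Uᵀ * U) * U.adjugate := by rw [hU, one_mul]
      _ = U.det • Uᵀ := by rw [mul_assoc, Matrix.mul_adjugate]; simp
  have h2 : ∀ j, U.adjugate 2 j = U.det * U j 2 := fun j => by rw [h]; simp
  have a0 := h2 0
  have a1 := h2 1
  have a2 := h2 2
  simp only [Matrix.adjugate_fin_three, Matrix.of_apply, Matrix.cons_val] at a0 a1 a2
  ext i
  fin_cases i <;> simp [cross_apply] <;> linarith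

lemma col_dotProduct_of_orthogonal {U : Matrix (Fin 3) (Fin 3) ℝ} (hU : Uᵀ * U = 1)
    (i j : Fin 3) : U.col i ⬝ᵥ U.col j = (1 : Matrix (Fin 3) (Fin 3) ℝ) i j := by
  rw [← hU]; rfl

lemma pauliVec_col_mul {U : Matrix (Fin 3) (Fin 3) ℝ} (hU : Uᵀ * U = 1) :
    pauliVec (U.col 0) * pauliVec (U.col 1) = (Complex.I * (U.det : ℂ)) • pauliVec (U.col 2) := by
  rw [pauliVec_mul, crossProduct_col_of_orthogonal hU, col_dotProduct_of_orthogonal hU,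
    pauliVec_smul]
  simp [-Complex.coe_smul, smul_smul]

lemma pauliVec_col_mul_swap {U : Matrix (Fin 3) (Fin 3) ℝ} (hU : Uᵀ * U = 1) :
    pauliVec (U.col 1) * pauliVec (U.col 0) = (-(Complex.I * (U.det : ℂ))) • pauliVec (U.col 2) := by
  rw [pauliVec_mul, ← cross_anticomm, crossProduct_col_of_orthogonal hU,
    col_dotProduct_of_orthogonal hU, ← neg_smul, pauliVec_smul]
  simp [-Complex.coe_smul, smul_smul]

/-- The two-qubit operator with real coefficient matrix `X` in the Pauli basis. -/
noncomputable def pauliOp (X : Matrix (Fin 3) (Fin 3) ℝ) :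
    Matrix (Fin 2 × Fin 2) (Fin 2 × Fin 2) ℂ :=
  ∑ k, ∑ l, (X k l : ℂ) • (pauli k ⊗ₖ pauli l)

lemma pauliVec_kronecker (u v : Fin 3 → ℝ) :
    pauliVec u ⊗ₖ pauliVec v = pauliOp (vecMulVec u v) := by
  ext ⟨a, b⟩ ⟨c, d⟩
  simp only [pauliVec, pauliOp, kroneckerMap_apply, Matrix.sum_apply, Matrix.smul_apply,
    smul_eq_mul, vecMulVec_apply, Finset.sum_mul_sum, Complex.ofReal_mul]
  exact Finset.sum_congr rfl fun k _ => Finset.sum_congr rfl fun l _ => by ring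

lemma pauliOp_sum {ι : Type*} (s : Finset ι) (f : ι → Matrix (Fin 3) (Fin 3) ℝ) :
    pauliOp (∑ i ∈ s, f i) = ∑ i ∈ s, pauliOp (f i) := by
  simp only [pauliOp, Matrix.sum_apply, Complex.ofReal_sum, Finset.sum_smul]
  rw [Finset.sum_comm (s := s)]
  refine Finset.sum_congr rfl fun k _ => ?_
  rw [Finset.sum_comm (s := s)]

lemma pauliOp_smul (c : ℝ) (X : Matrix (Fin 3) (Fin 3) ℝ) :
    pauliOp (c • X) = (c : ℂ) • pauliOp X := by
  simp only [pauliOp, Matrix.smul_apply, smul_eq_mul, Complex.ofReal_mul, Finset.smul_sum, smul_smul]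

lemma trace_transpose_mul_corr {m : ℕ} (A B : Matrix (Fin m) (Fin 3) ℝ)
    (Z : Matrix (Fin m) (Fin m) ℝ) (ρ : Matrix (Fin 2 × Fin 2) (Fin 2 × Fin 2) ℂ) :
    (Zᵀ * corr A B ρ).trace = ((ρ * pauliOp (Aᵀ * Z * B)).trace).re := by
  have hX : Aᵀ * Z * B = ∑ j, ∑ i, Z i j • vecMulVec (A.row i) (B.row j) := by
    ext k l
    simp only [Matrix.mul_apply, Matrix.sum_apply, Matrix.smul_apply, vecMulVec_apply,
      Matrix.row_apply, Matrix.transpose_apply, smul_eq_mul, Finset.sum_mul]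
    exact Finset.sum_congr rfl fun j _ => Finset.sum_congr rfl fun i _ => by ring
  rw [hX, pauliOp_sum]
  simp only [pauliOp_sum, pauliOp_smul, ← pauliVec_kronecker, Matrix.mul_sum, Matrix.trace_sum,
    Matrix.mul_smul, Matrix.trace_smul, Complex.re_sum, smul_eq_mul, Complex.re_ofReal_mul]
  simp only [Matrix.trace, Matrix.diag, Matrix.mul_apply (M := Zᵀ), Matrix.transpose_apply, corr,
    Matrix.of_apply]
  rfl

lemma trace_mul_conjTranspose_mul_self_nonneg {n : Type*} [Fintype n] {ρ : Matrix n n ℂ}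
    (hρ : ρ.PosSemidef) (F : Matrix n n ℂ) :
    0 ≤ ((ρ * (Fᴴ * F)).trace).re := by
  have h := (hρ.mul_mul_conjTranspose_same F).trace_nonneg
  rw [mul_assoc, Matrix.trace_mul_comm, mul_assoc] at h
  exact (Complex.le_def.1 h).1

section Involutions

variable {n : Type*} [Fintype n] [DecidableEq n] {P Q ρ : Matrix n n ℂ}

lemma one_add_mul_one_add_eq (hP : P.IsHermitian) (hQ : Q.IsHermitian) (hPP : P * P = 1)
    (hQQ : Q * Q = 1) (hPQ : P * Q = Q * P) :
    ((1 + P) * (1 + Q))ᴴ * ((1 + P) * (1 + Q)) = (4 : ℂ) • ((1 + P) * (1 + Q)) := by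
  have h1 : ((1 + P) * (1 + Q))ᴴ = (1 + Q) * (1 + P) := by
    simp [Matrix.conjTranspose_mul, hP.eq, hQ.eq]
  have h2 : (1 + P) * (1 + P) = (2 : ℂ) • (1 + P) := by
    rw [two_smul]; noncomm_ring; rw [hPP]; abel
  have h3 : (1 + Q) * (1 + Q) = (2 : ℂ) • (1 + Q) := by
    rw [two_smul]; noncomm_ring; rw [hQQ]; abel
  have h4 : (1 + Q) * (1 + P) = (1 + P) * (1 + Q) := by
    noncomm_ring; rw [hPQ]
  calc _ = (1 + Q) * ((1 + P) * (1 + P)) * (1 + Q) := by rw [h1]; noncomm_ring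
    _ = (2 : ℂ) • ((1 + Q) * (1 + P) * (1 + Q)) := by
      rw [h2, Matrix.mul_smul, Matrix.smul_mul]
    _ = (2 : ℂ) • ((1 + P) * ((1 + Q) * (1 + Q))) := by rw [h4, mul_assoc]
    _ = _ := by rw [h3, Matrix.mul_smul, smul_smul]; norm_num

lemma trace_involutions_nonneg (hP : P.IsHermitian) (hQ : Q.IsHermitian) (hPP : P * P = 1)
    (hQQ : Q * Q = 1) (hPQ : P * Q = Q * P) (hρ : ρ.PosSemidef) (hρ1 : ρ.trace = 1) :
    0 ≤ 1 + ((ρ * P).trace).re + ((ρ * Q).trace).re + ((ρ * (P * Q)).trace).re := by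
  have h := trace_mul_conjTranspose_mul_self_nonneg hρ ((1 + P) * (1 + Q))
  rw [one_add_mul_one_add_eq hP hQ hPP hQQ hPQ,
    show (1 + P) * (1 + Q) = 1 + P + Q + P * Q by noncomm_ring] at h
  simp only [Matrix.mul_smul, Matrix.trace_smul, mul_add, Matrix.trace_add, mul_one, hρ1,
    smul_eq_mul, Complex.add_re, Complex.mul_re] at h
  norm_num at h
  linarith

/-- The largest mean value of `a P + b Q - c P Q` for commuting involutions `P`, `Q`. -/
lemma trace_involutions_le (hP : P.IsHermitian) (hQ : Q.IsHermitian) (hPP : P * P = 1)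
    (hQQ : Q * Q = 1) (hPQ : P * Q = Q * P) (hρ : ρ.PosSemidef) (hρ1 : ρ.trace = 1)
    {a b c : ℝ} (hab : 0 ≤ a + b) (hca : c ≤ a) (hcb : c ≤ b) :
    a * ((ρ * P).trace).re + b * ((ρ * Q).trace).re - c * ((ρ * (P * Q)).trace).re
      ≤ a + b - c := by
  have h2 := trace_involutions_nonneg hP hQ.neg hPP (by simpa using hQQ) (by simpa using hPQ)
    hρ hρ1
  have h3 := trace_involutions_nonneg hP.neg hQ (by simpa using hPP) hQQ (by simpa using hPQ)
    hρ hρ1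
  have h4 := trace_involutions_nonneg hP.neg hQ.neg (by simpa using hPP) (by simpa using hQQ)
    (by simpa using hPQ) hρ hρ1
  simp only [Matrix.mul_neg, Matrix.neg_mul, Matrix.trace_neg, Complex.neg_re, neg_neg]
    at h2 h3 h4
  nlinarith [mul_nonneg (sub_nonneg.2 hcb) h2, mul_nonneg (sub_nonneg.2 hca) h3,
    mul_nonneg hab h4]

/-- A joint eigenstate of two commuting involutions. -/
lemma exists_state_involutions (hP : P.IsHermitian) (hQ : Q.IsHermitian) (hPP : P * P = 1)
    (hQQ : Q * Q = 1) (hPQ : P * Q = Q * P) (hP0 : P.trace = 0) (hQ0 : Q.trace = 0)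
    (hPQ0 : (P * Q).trace = 0) (hn : Fintype.card n = 4) :
    ∃ ρ : Matrix n n ℂ, ρ.PosSemidef ∧ ρ.trace = 1 ∧ ρ * P = ρ ∧ ρ * Q = ρ := by
  refine ⟨(4 : ℂ)⁻¹ • ((1 + P) * (1 + Q)), ?_, ?_, ?_, ?_⟩
  · have h := (Matrix.posSemidef_conjTranspose_mul_self ((1 + P) * (1 + Q))).smul
      (show (0 : ℝ) ≤ 1 / 16 by norm_num)
    rw [one_add_mul_one_add_eq hP hQ hPP hQQ hPQ] at h
    convert h using 1
    rw [← Complex.coe_smul, smul_smul]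
    norm_num
  · rw [show (1 + P) * (1 + Q) = 1 + P + Q + P * Q by noncomm_ring]
    simp [hP0, hQ0, hPQ0, hn]
  · rw [Matrix.smul_mul]
    congr 1
    calc (1 + P) * (1 + Q) * P = P + P * P + Q * P + P * (Q * P) := by noncomm_ring
      _ = (1 + P) * (1 + Q) := by
        rw [← hPQ, ← mul_assoc P P Q, hPP]; noncomm_ring
  · rw [Matrix.smul_mul, mul_assoc, add_mul 1 Q Q, hQQ, one_mul, add_comm Q]

end Involutions

lemma sval_antitone (X : Matrix (Fin 3) (Fin 3) ℝ) : Antitone (sval X) := fun _ _ h =>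
  Real.sqrt_le_sqrt (Tuple.monotone_sort (isHermitian_tr_mul_self X).eigenvalues
    (Fin.rev_le_rev.2 h))

lemma sval_sq (X : Matrix (Fin 3) (Fin 3) ℝ) (i : Fin 3) :
    sval X i ^ 2 = (isHermitian_tr_mul_self X).eigenvalues
      (Tuple.sort (isHermitian_tr_mul_self X).eigenvalues i.rev) := by
  have h : (Xᵀ * X).PosSemidef := by
    simpa [Matrix.conjTranspose_eq_transpose_of_trivial] using
      Matrix.posSemidef_conjTranspose_mul_self X
  exact Real.sq_sqrt (h.eigenvalues_nonneg _)

lemma orthonormalBasis_transpose_mul_self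
    (b : OrthonormalBasis (Fin 3) ℝ (EuclideanSpace ℝ (Fin 3))) :
    (Matrix.of fun i j => b j i)ᵀ * (Matrix.of fun i j => b j i) = 1 := by
  ext i j
  have h := orthonormal_iff_ite.1 b.orthonormal i j
  simp only [PiLp.inner_apply, RCLike.inner_apply, conj_trivial] at h
  simp only [Matrix.mul_apply, Matrix.transpose_apply, Matrix.of_apply, Matrix.one_apply, ← h]
  exact Finset.sum_congr rfl fun k _ => mul_comm _ _

/-- Singular value decomposition of a real `3 × 3` matrix. -/
lemma exists_svd (X : Matrix (Fin 3) (Fin 3) ℝ) :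
    ∃ U V : Matrix (Fin 3) (Fin 3) ℝ, Uᵀ * U = 1 ∧ Vᵀ * V = 1 ∧
      X = U * Matrix.diagonal (sval X) * Vᵀ := by
  have hX := isHermitian_tr_mul_self X
  let v : OrthonormalBasis (Fin 3) ℝ (EuclideanSpace ℝ (Fin 3)) :=
    hX.eigenvectorBasis.reindex (Fin.revPerm.trans (Tuple.sort hX.eigenvalues)).symm
  have hv : ∀ i, (Xᵀ * X) *ᵥ (v i).ofLp = sval X i ^ 2 • (v i).ofLp := fun i => by
    rw [sval_sq]
    simpa [v] using hX.mulVec_eigenvectorBasis (Tuple.sort hX.eigenvalues i.rev)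
  set V : Matrix (Fin 3) (Fin 3) ℝ := Matrix.of fun i j => v j i with hVdef
  have hV : Vᵀ * V = 1 := orthonormalBasis_transpose_mul_self v
  have hVV : V * Vᵀ = 1 := mul_eq_one_comm.1 hV
  have hXV : Xᵀ * X * V = V * Matrix.diagonal fun i => sval X i ^ 2 := by
    ext k i
    rw [Matrix.mul_diagonal]
    have := congrFun (hv i) k
    simpa [Matrix.mulVec, dotProduct, Matrix.mul_apply (M := Xᵀ * X), hVdef, mul_comm] using this
  have hW : (X * V)ᵀ * (X * V) = Matrix.diagonal fun i => sval X i ^ 2 := by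
    rw [Matrix.transpose_mul, mul_assoc, ← mul_assoc Xᵀ, hXV, ← mul_assoc, hV, one_mul]
  let u : Fin 3 → EuclideanSpace ℝ (Fin 3) := fun i =>
    (sval X i)⁻¹ • WithLp.toLp 2 ((X * V).col i)
  have hu : Orthonormal ℝ (Set.domRestrict {i | sval X i ≠ 0} u) := by
    rw [orthonormal_iff_ite]
    rintro ⟨i, hi⟩ ⟨j, hj⟩
    have h : ((X * V)ᵀ * (X * V)) j i = _ := congrFun (congrFun hW j) i
    have h' : inner ℝ (WithLp.toLp 2 ((X * V).col i)) (WithLp.toLp 2 ((X * V).col j)) =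
        ((X * V)ᵀ * (X * V)) j i := by
      simp only [PiLp.inner_apply, RCLike.inner_apply, conj_trivial, Matrix.col_apply,
        Matrix.mul_apply (M := (X * V)ᵀ), Matrix.transpose_apply]
    simp only [Set.mem_ofPred_eq] at hi hj
    simp only [Set.domRestrict_apply, u, inner_smul_left, inner_smul_right, h', h,
      Matrix.diagonal_apply, Subtype.mk.injEq]
    by_cases hij : i = j
    · subst hij
      simp
      field_simp
    · simp [hij, Ne.symm hij]
  obtain ⟨b, hb⟩ := hu.exists_orthonormalBasis_extension_of_card_eq (by simp)
  refine ⟨Matrix.of fun i j => b j i, V, orthonormalBasis_transpose_mul_self b, hV, ?_⟩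
  have hcol : X * V = (Matrix.of fun i j => b j i) * Matrix.diagonal (sval X) := by
    ext k i
    rw [Matrix.mul_diagonal, Matrix.of_apply]
    by_cases hi : sval X i = 0
    · have h : ((X * V)ᵀ * (X * V)) i i = _ := congrFun (congrFun hW i) i
      rw [Matrix.diagonal_apply_eq, hi, Matrix.mul_apply] at h
      have h0 := (Finset.sum_eq_zero_iff_of_nonneg (fun l _ => by
        rw [Matrix.transpose_apply]; exact mul_self_nonneg _)).1 (h.trans (by norm_num)) k
          (Finset.mem_univ _)
      rw [Matrix.transpose_apply, mul_self_eq_zero] at h0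
      rw [h0, hi, mul_zero]
    · rw [hb i hi]
      simp only [u, PiLp.smul_apply, smul_eq_mul, Matrix.col_apply]
      field_simp
  rw [← hcol, mul_assoc, hVV, mul_one]

lemma det_mul_self_of_orthogonal {U : Matrix (Fin 3) (Fin 3) ℝ} (hU : Uᵀ * U = 1) :
    U.det * U.det = 1 := by
  simpa using congrArg Matrix.det hU

/-- Support function of the quantum correlation set:
`φ_{C_qm}(Z) = s₁ + s₂ − sgn(det(AᵀZB))·s₃`. -/
theorem stmt2 {m : ℕ} (hm : 1 ≤ m) (A B : Matrix (Fin m) (Fin 3) ℝ)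
    (hA : ∀ i, ∑ k, A i k ^ 2 = 1) (hB : ∀ i, ∑ k, B i k ^ 2 = 1)
    (Z : Matrix (Fin m) (Fin m) ℝ) :
    suppFn (Cqm A B) Z =
      sval (Aᵀ * Z * B) 0 + sval (Aᵀ * Z * B) 1 -
        Real.sign (Aᵀ * Z * B).det * sval (Aᵀ * Z * B) 2 := by
  set X := Aᵀ * Z * B with hXdef
  obtain ⟨U, V, hU, hV, hX⟩ := exists_svd X
  set s := sval X with hs
  have hs01 : s 1 ≤ s 0 := sval_antitone X (by decide)
  have hs12 : s 2 ≤ s 1 := sval_antitone X (by decide)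
  have hs2 : 0 ≤ s 2 := sval_nonneg X 2
  set e := U.det * V.det with he
  have hee : e * e = 1 := by
    rw [he, mul_mul_mul_comm, det_mul_self_of_orthogonal hU, det_mul_self_of_orthogonal hV, one_mul]
  have hsign : Real.sign X.det * s 2 = e * s 2 := by
    rcases hs2.eq_or_lt with h | h
    · rw [← h, mul_zero, mul_zero]
    · have hdet : X.det = e * (s 0 * s 1 * s 2) := by
        rw [hX, Matrix.det_mul, Matrix.det_mul, Matrix.det_transpose, Matrix.det_diagonal,
          Fin.prod_univ_three, he]
        ring
      have hpos : 0 < s 0 * s 1 * s 2 := by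
        have h1 : 0 < s 1 := by linarith
        have h0 : 0 < s 0 := by linarith
        positivity
      rw [hdet]
      rcases mul_self_eq_one_iff.1 hee with h1 | h1
      · rw [h1, one_mul, Real.sign_of_pos hpos]
      · rw [h1, Real.sign_of_neg (by linarith)]
  rw [hsign]
  set P := pauliVec (U.col 0) ⊗ₖ pauliVec (V.col 0) with hPdef
  set Q := pauliVec (U.col 1) ⊗ₖ pauliVec (V.col 1) with hQdef
  set R := pauliVec (U.col 2) ⊗ₖ pauliVec (V.col 2) with hRdef
  have hherm : ∀ u v, (pauliVec u ⊗ₖ pauliVec v).IsHermitian := fun u v => by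
    rw [Matrix.IsHermitian, Matrix.conjTranspose_kronecker, (pauliVec_isHermitian u).eq,
      (pauliVec_isHermitian v).eq]
  have hsq : ∀ i,
      pauliVec (U.col i) ⊗ₖ pauliVec (V.col i) * pauliVec (U.col i) ⊗ₖ pauliVec (V.col i) = 1 :=
    fun i => by
      rw [← Matrix.mul_kronecker_mul,
        pauliVec_mul_self ((col_dotProduct_of_orthogonal hU i i).trans (Matrix.one_apply_eq i)),
        pauliVec_mul_self ((col_dotProduct_of_orthogonal hV i i).trans (Matrix.one_apply_eq i)),
        Matrix.one_kronecker_one]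
  have hPQR : P * Q = -(e : ℂ) • R := by
    rw [hPdef, hQdef, hRdef, ← Matrix.mul_kronecker_mul, pauliVec_col_mul hU, pauliVec_col_mul hV,
      Matrix.smul_kronecker, Matrix.kronecker_smul, smul_smul, he]
    congr 1
    push_cast
    linear_combination (U.det * V.det : ℂ) * Complex.I_mul_I
  have hQPR : Q * P = -(e : ℂ) • R := by
    rw [hPdef, hQdef, hRdef, ← Matrix.mul_kronecker_mul, pauliVec_col_mul_swap hU,
      pauliVec_col_mul_swap hV, Matrix.smul_kronecker, Matrix.kronecker_smul, smul_smul, he]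
    congr 1
    push_cast
    linear_combination (U.det * V.det : ℂ) * Complex.I_mul_I
  have hPQ : P * Q = Q * P := hPQR.trans hQPR.symm
  have hR : R = -(e : ℂ) • (P * Q) := by
    rw [hPQR, smul_smul, neg_mul_neg, ← Complex.ofReal_mul, hee, Complex.ofReal_one, one_smul]
  have htr : ∀ u v, (pauliVec u ⊗ₖ pauliVec v).trace = 0 := fun u v => by
    rw [Matrix.trace_kronecker, pauliVec_trace, zero_mul]
  have hop : pauliOp X = (s 0 : ℂ) • P + (s 1 : ℂ) • Q - ((e * s 2 : ℝ) : ℂ) • (P * Q) := by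
    have hsum : X = ∑ i, s i • vecMulVec (U.col i) (V.col i) := by
      conv_lhs => rw [hX]
      ext k l
      simp only [Matrix.mul_apply (N := Vᵀ), Matrix.mul_diagonal, Matrix.sum_apply,
        Matrix.smul_apply, vecMulVec_apply, Matrix.col_apply,
        Matrix.transpose_apply, smul_eq_mul]
      exact Finset.sum_congr rfl fun i _ => by ring
    conv_lhs => rw [hsum]
    simp only [pauliOp_sum, pauliOp_smul, ← pauliVec_kronecker]
    rw [Fin.sum_univ_three, ← hPdef, ← hQdef, ← hRdef, hR, smul_smul, sub_eq_add_neg, ← neg_smul]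
    congr 2
    push_cast
    ring
  have hval : ∀ ρ, (Zᵀ * corr A B ρ).trace = s 0 * ((ρ * P).trace).re +
      s 1 * ((ρ * Q).trace).re - e * s 2 * ((ρ * (P * Q)).trace).re := fun ρ => by
    rw [trace_transpose_mul_corr, ← hXdef, hop]
    simp only [mul_add, mul_sub, Matrix.mul_smul, Matrix.trace_add, Matrix.trace_sub,
      Matrix.trace_smul, smul_eq_mul, Complex.add_re, Complex.sub_re, Complex.re_ofReal_mul]
  have hes : e * s 2 ≤ s 2 := by
    rcases mul_self_eq_one_iff.1 hee with h1 | h1 <;> rw [h1] <;> linarith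
  refine IsGreatest.csSup_eq ⟨?_, ?_⟩
  · obtain ⟨ρ, hρ, hρ1, hρP, hρQ⟩ := exists_state_involutions (hherm _ _) (hherm _ _) (hsq 0)
      (hsq 1) hPQ (htr _ _) (htr _ _)
      (by rw [← hPdef, ← hQdef, hPQR, Matrix.trace_smul, htr, smul_zero]) (by simp)
    refine ⟨corr A B ρ, ⟨ρ, ⟨hρ, hρ1⟩, rfl⟩, ?_⟩
    change (Zᵀ * corr A B ρ).trace = _
    rw [hval, ← mul_assoc, hρP, hρQ, hρ1, Complex.one_re]
    ring
  · rintro _ ⟨_, ⟨ρ, ⟨hρ, hρ1⟩, rfl⟩, rfl⟩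
    change (Zᵀ * corr A B ρ).trace ≤ _
    rw [hval]
    exact trace_involutions_le (hherm _ _) (hherm _ _) (hsq 0) (hsq 1) hPQ hρ hρ1
      (by linarith) (by linarith) (by linarith)

end BellCorr
end
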